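/- Let G be a finite simple graph of order m, and let Ĝ be the graph obtained from G as follows: for every vertex v of G, add two new disjoint triangles T_v and T_v', together with an edge joining v to one vertex of T_v and an edge joining v to one vertex of T_v'. Then Ĝ has order 7m and ι_g(Ĝ) = ι_g'(Ĝ) = 3m = (3/7)·|V(Ĝ)|. -/

import Mathlib

open SimpleGraph

variable {V : Type*}

/-- The closed neighborhood `N_G[X]` of a set `X` of vertices: all vertices that are in `X`
or adjacent to a vertex of `X`. -/
def closedNbhdSet (G : SimpleGraph V) (X : Set V) : Set V :=
  {u | u ∈ X ∨ ∃ x ∈ X, G.Adj x u}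

/-- A vertex `v` is playable with respect to the set `X` of already selected vertices if the
closed neighborhood of `v` contains a vertex `u ∉ N_G[X]` having a neighbor `w ∉ N_G[X]`,
i.e. `v` dominates a vertex of a nontrivial component of `G - N_G[X]`. -/
def IsPlayable (G : SimpleGraph V) (X : Set V) (v : V) : Prop :=
  ∃ u, (u = v ∨ G.Adj v u) ∧ u ∉ closedNbhdSet G X ∧
    ∃ w, G.Adj u w ∧ w ∉ closedNbhdSet G X

open Classical in
/-- The optimal-play value (number of further selected vertices) of the isolation game
position with given fuel, player to move (`true` = Dominator, the minimizer;
`false` = Staller, the maximizer) and set `X` of already selected vertices. -/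
noncomputable def isoGameVal (G : SimpleGraph V) : ℕ → Bool → Set V → ℕ
  | 0, _, _ => 0
  | (k + 1), isDom, X =>
    if ∃ v, IsPlayable G X v then
      (if isDom then sInf else sSup)
        {n : ℕ | ∃ v, IsPlayable G X v ∧ n = isoGameVal G k (!isDom) (insert v X) + 1}
    else 0

/-- The game isolation number `ι_g(G)`: the number of vertices selected in the isolation
game on `G` when Dominator moves first and both players play optimally.  (A game on a
graph with `n` vertices lasts at most `n` moves, so fuel `Fintype.card V` suffices.) -/
noncomputable def iotaGame (G : SimpleGraph V) [Fintype V] : ℕ :=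
  isoGameVal G (Fintype.card V) true ∅

/-- The Staller-start game isolation number `ι_g'(G)`: the number of vertices selected in
the isolation game on `G` when Staller moves first and both players play optimally. -/
noncomputable def iotaGame' (G : SimpleGraph V) [Fintype V] : ℕ :=
  isoGameVal G (Fintype.card V) false ∅

/-- The relation generating the graph `Ĝ`: keep the edges of `G` on the original vertices
(the `Sum.inl` copy), put a triangle on each of the two added triples `T_v` and `T_v'`
(the vertices `(v, i)` in the two `Sum.inr` copies of `V × Fin 3`), and join each original
vertex `v` to one vertex of `T_v` and one vertex of `T_v'` (namely `(v, 0)` in each copy). -/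
def hatRel (G : SimpleGraph V) :
    (V ⊕ ((V × Fin 3) ⊕ (V × Fin 3))) → (V ⊕ ((V × Fin 3) ⊕ (V × Fin 3))) → Prop
  | Sum.inl u, Sum.inl v => G.Adj u v
  | Sum.inl u, Sum.inr (Sum.inl (v, i)) => u = v ∧ i = 0
  | Sum.inl u, Sum.inr (Sum.inr (v, i)) => u = v ∧ i = 0
  | Sum.inr (Sum.inl (u, _)), Sum.inr (Sum.inl (v, _)) => u = v
  | Sum.inr (Sum.inr (u, _)), Sum.inr (Sum.inr (v, _)) => u = v
  | _, _ => False

/-- The graph `Ĝ` obtained from `G` by attaching, at every vertex `v`, two disjoint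
triangles `T_v` and `T_v'`, each joined to `v` by a single edge. -/
def hatGraph (G : SimpleGraph V) : SimpleGraph (V ⊕ ((V × Fin 3) ⊕ (V × Fin 3))) :=
  SimpleGraph.fromRel (hatRel G)

section Game

variable {W : Type*} {H : SimpleGraph W}

lemma IsPlayable.notMem {X : Set W} {x : W} (h : IsPlayable H X x) : x ∉ X := by
  rintro hx
  obtain ⟨u, rfl | hu, hu', -⟩ := h
  · exact hu' (Or.inl hx)
  · exact hu' (Or.inr ⟨x, hx, hu⟩)

lemma IsPlayable.ncard_insert [Finite W] {X : Set W} {x : W} (h : IsPlayable H X x) :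
    (insert x X).ncard = X.ncard + 1 :=
  Set.ncard_insert_of_notMem h.notMem

lemma isoGameVal_eq_zero {X : Set W} (h : ¬ ∃ x, IsPlayable H X x) (k : ℕ) (b : Bool) :
    isoGameVal H k b X = 0 := by
  cases k <;> simp [isoGameVal, h]

lemma isoGameVal_true_succ_le {X : Set W} {x : W} (h : IsPlayable H X x) (k : ℕ) :
    isoGameVal H (k + 1) true X ≤ isoGameVal H k false (insert x X) + 1 := by
  have hex : ∃ x, IsPlayable H X x := ⟨x, h⟩
  simp only [isoGameVal, if_pos hex, if_true]
  exact Nat.sInf_le ⟨x, h, rfl⟩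

lemma exists_isoGameVal_true_succ_eq {X : Set W} (h : ∃ x, IsPlayable H X x) (k : ℕ) :
    ∃ x, IsPlayable H X x ∧
      isoGameVal H (k + 1) true X = isoGameVal H k false (insert x X) + 1 := by
  obtain ⟨y, hy⟩ := id h
  simp only [isoGameVal, if_pos h, if_true]
  exact Nat.sInf_mem (s := {n | ∃ x, IsPlayable H X x ∧
    n = isoGameVal H k false (insert x X) + 1}) ⟨_, y, hy, rfl⟩

lemma isoGameVal_le_fuel (k : ℕ) (b : Bool) (X : Set W) : isoGameVal H k b X ≤ k := by
  induction k generalizing b X with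
  | zero => simp [isoGameVal]
  | succ k ih =>
    by_cases h : ∃ x, IsPlayable H X x
    · obtain ⟨y, hy⟩ := id h
      cases b
      · simp only [isoGameVal, if_pos h]
        refine csSup_le ⟨_, y, hy, rfl⟩ ?_
        rintro _ ⟨x, -, rfl⟩
        exact Nat.succ_le_succ (ih _ _)
      · exact (isoGameVal_true_succ_le hy k).trans (Nat.succ_le_succ (ih _ _))
    · simp [isoGameVal_eq_zero h]

lemma le_isoGameVal_false_succ {X : Set W} {x : W} (h : IsPlayable H X x) (k : ℕ) :
    isoGameVal H k true (insert x X) + 1 ≤ isoGameVal H (k + 1) false X := by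
  have hex : ∃ x, IsPlayable H X x := ⟨x, h⟩
  simp only [isoGameVal, if_pos hex]
  refine le_csSup ⟨k + 1, ?_⟩ ⟨x, h, rfl⟩
  rintro _ ⟨y, -, rfl⟩
  exact Nat.succ_le_succ (isoGameVal_le_fuel _ _ _)

lemma isoGameVal_false_succ_le {X : Set W} (k B : ℕ)
    (h : ∀ x, IsPlayable H X x → isoGameVal H k true (insert x X) + 1 ≤ B) :
    isoGameVal H (k + 1) false X ≤ B := by
  by_cases hex : ∃ x, IsPlayable H X x
  · obtain ⟨y, hy⟩ := id hex
    simp only [isoGameVal, if_pos hex]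
    refine csSup_le ⟨_, y, hy, rfl⟩ ?_
    rintro _ ⟨x, hx, rfl⟩
    exact h x hx
  · simp [isoGameVal_eq_zero hex]

/-- A strategy for Dominator that maintains `P b` (where `b` is the player to move) keeps the
number of selected vertices below any bound that `P` imposes. -/
lemma isoGameVal_add_ncard_le [Finite W] {N : ℕ} (P : Bool → Set W → Prop)
    (hcard : ∀ b X, P b X → X.ncard ≤ N)
    (hstaller : ∀ X x, P false X → IsPlayable H X x → P true (insert x X))
    (hdom : ∀ X, P true X → (∃ x, IsPlayable H X x) →
      ∃ x, IsPlayable H X x ∧ P false (insert x X))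
    (k : ℕ) (b : Bool) (X : Set W) (hX : P b X) : isoGameVal H k b X + X.ncard ≤ N := by
  induction k generalizing b X with
  | zero => simpa [isoGameVal] using hcard b X hX
  | succ k ih =>
    have hN := hcard b X hX
    by_cases h : ∃ x, IsPlayable H X x
    · cases b
      · suffices isoGameVal H (k + 1) false X ≤ N - X.ncard by omega
        refine isoGameVal_false_succ_le k _ fun x hx => ?_
        have h₁ := ih true _ (hstaller X x hX hx)
        have h₂ := hx.ncard_insert
        omega
      · obtain ⟨x, hx, hP⟩ := hdom X hX h
        have h₁ := ih false _ hP
        have h₂ := hx.ncard_insert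
        have h₃ := isoGameVal_true_succ_le hx k
        omega
    · simpa [isoGameVal_eq_zero h] using hN

/-- A strategy for Staller that maintains `P b` (where `b` is the player to move) guarantees the
number of selected vertices that `P` forces at the end of the game. -/
lemma le_isoGameVal_add_ncard [Finite W] {N : ℕ} (P : Bool → Set W → Prop)
    (hend : ∀ b X, P b X → (¬ ∃ x, IsPlayable H X x) → N ≤ X.ncard)
    (hdom : ∀ X x, P true X → IsPlayable H X x → P false (insert x X))
    (hstaller : ∀ X, P false X → (∃ x, IsPlayable H X x) →
      ∃ x, IsPlayable H X x ∧ P true (insert x X))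
    (k : ℕ) (b : Bool) (X : Set W) (hX : P b X) (hk : N ≤ k + X.ncard) :
    N ≤ isoGameVal H k b X + X.ncard := by
  induction k generalizing b X with
  | zero => omega
  | succ k ih =>
    by_cases h : ∃ x, IsPlayable H X x
    · cases b
      · obtain ⟨x, hx, hP⟩ := hstaller X hX h
        have h₂ := hx.ncard_insert
        have h₁ := ih true _ hP (by omega)
        have h₃ := le_isoGameVal_false_succ hx k
        omega
      · obtain ⟨x, hx, hval⟩ := exists_isoGameVal_true_succ_eq h k
        have h₂ := hx.ncard_insert
        have h₁ := ih false _ (hdom X x hX hx) (by omega)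
        omega
    · have := hend b X hX h
      omega

end Game

section HatGraph

/-- The vertex of `Ĝ` corresponding to the vertex `v` of `G`. -/
def core (v : V) : V ⊕ ((V × Fin 3) ⊕ (V × Fin 3)) := Sum.inl v

/-- The `i`-th vertex of one of the two triangles attached at `v`; the side `s` selects the
triangle. -/
def tri (v : V) (s : Bool) (i : Fin 3) : V ⊕ ((V × Fin 3) ⊕ (V × Fin 3)) :=
  Sum.inr (if s then Sum.inr (v, i) else Sum.inl (v, i))

lemma eq_core_or_eq_tri (x : V ⊕ ((V × Fin 3) ⊕ (V × Fin 3))) :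
    (∃ v, x = core v) ∨ ∃ v s i, x = tri v s i := by
  rcases x with v | ⟨v, i⟩ | ⟨v, i⟩
  · exact Or.inl ⟨v, rfl⟩
  · exact Or.inr ⟨v, false, i, rfl⟩
  · exact Or.inr ⟨v, true, i, rfl⟩

@[simp] lemma core_inj {v w : V} : core v = core w ↔ v = w := by simp [core]

@[simp] lemma core_ne_tri {v w : V} {s : Bool} {i : Fin 3} : core v ≠ tri w s i := by
  simp [core, tri]

@[simp] lemma tri_ne_core {v w : V} {s : Bool} {i : Fin 3} : tri w s i ≠ core v := by
  simp [core, tri]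

@[simp] lemma tri_inj {v w : V} {s t : Bool} {i j : Fin 3} :
    tri v s i = tri w t j ↔ v = w ∧ s = t ∧ i = j := by
  cases s <;> cases t <;> simp [tri]

variable {G : SimpleGraph V} {X : Set (V ⊕ ((V × Fin 3) ⊕ (V × Fin 3)))} {v : V}

@[simp] lemma hatGraph_adj_tri_tri {w : V} {s t : Bool} {i j : Fin 3} :
    (hatGraph G).Adj (tri v s i) (tri w t j) ↔ v = w ∧ s = t ∧ i ≠ j := by
  cases s <;> cases t <;> simp [tri, hatGraph, hatRel] <;> grind

@[simp] lemma hatGraph_adj_core_tri {w : V} {t : Bool} {j : Fin 3} :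
    (hatGraph G).Adj (core v) (tri w t j) ↔ v = w ∧ j = 0 := by
  cases t <;> simp [tri, core, hatGraph, hatRel]

@[simp] lemma hatGraph_adj_tri_core {w : V} {t : Bool} {j : Fin 3} :
    (hatGraph G).Adj (tri w t j) (core v) ↔ v = w ∧ j = 0 := by
  rw [adj_comm, hatGraph_adj_core_tri]

lemma tri_mem_closedNbhdSet_iff {s : Bool} {i : Fin 3} :
    tri v s i ∈ closedNbhdSet (hatGraph G) X ↔
      (∃ j, tri v s j ∈ X) ∨ i = 0 ∧ core v ∈ X := by
  constructor
  · rintro (h | ⟨x, hx, hadj⟩)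
    · exact Or.inl ⟨i, h⟩
    · rcases eq_core_or_eq_tri x with ⟨w, rfl⟩ | ⟨w, t, j, rfl⟩
      · simp only [hatGraph_adj_core_tri] at hadj
        grind
      · simp only [hatGraph_adj_tri_tri] at hadj
        grind
  · rintro (⟨j, hj⟩ | ⟨rfl, h⟩)
    · by_cases hij : j = i
      · exact Or.inl (hij ▸ hj)
      · exact Or.inr ⟨_, hj, by simp [hij]⟩
    · exact Or.inr ⟨_, h, by simp⟩

lemma core_mem_closedNbhdSet {s : Bool} (h : core v ∈ X ∨ tri v s 0 ∈ X) :
    core v ∈ closedNbhdSet (hatGraph G) X :=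
  h.imp id fun h => ⟨_, h, by simp⟩

lemma isPlayable_tri {s : Bool} (h : ∀ j, tri v s j ∉ X) (i : Fin 3) :
    IsPlayable (hatGraph G) X (tri v s i) := by
  refine ⟨tri v s 1, ?_, ?_, tri v s 2, by simp, ?_⟩
  · simp only [tri_inj, hatGraph_adj_tri_tri, true_and]
    exact (eq_or_ne 1 i).imp id Ne.symm
  all_goals simp [tri_mem_closedNbhdSet_iff, h]

lemma isPlayable_core {s : Bool} (h : ∀ j, tri v s j ∉ X) (hv : core v ∉ X) :
    IsPlayable (hatGraph G) X (core v) := by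
  refine ⟨tri v s 0, by simp, ?_, tri v s 1, by simp, ?_⟩ <;>
    simp [tri_mem_closedNbhdSet_iff, h, hv]

lemma not_isPlayable_tri {s t : Bool} {j : Fin 3} (h : tri v s j ∈ X)
    (hv : core v ∈ X ∨ tri v t 0 ∈ X) (i : Fin 3) :
    ¬ IsPlayable (hatGraph G) X (tri v s i) := by
  rintro ⟨u, hu, hu', -⟩
  rcases eq_core_or_eq_tri u with ⟨w, rfl⟩ | ⟨w, r, l, rfl⟩
  · simp only [core_ne_tri, hatGraph_adj_tri_core, false_or] at hu
    exact hu' (hu.1 ▸ core_mem_closedNbhdSet hv)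
  · simp only [tri_inj, hatGraph_adj_tri_tri] at hu
    refine hu' (tri_mem_closedNbhdSet_iff.2 (Or.inl ⟨j, ?_⟩))
    grind

open Classical in
lemma ncard_eq_sum_gadget [Fintype V] (X : Set (V ⊕ ((V × Fin 3) ⊕ (V × Fin 3)))) :
    X.ncard = ∑ v : V, ((if core v ∈ X then 1 else 0) +
      ((∑ i, if tri v false i ∈ X then 1 else 0) + ∑ i, if tri v true i ∈ X then 1 else 0)) := by
  rw [Set.ncard_eq_toFinset_card', ← Set.filter_mem_univ_eq_toFinset, Finset.card_filter,
    Fintype.sum_sum_type, Fintype.sum_sum_type, Fintype.sum_prod_type, Fintype.sum_prod_type]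
  simp only [Finset.sum_add_distrib]
  rfl

/-- No vertex of the gadget at `v` has been selected. -/
def Fresh (X : Set (V ⊕ ((V × Fin 3) ⊕ (V × Fin 3)))) (v : V) : Prop :=
  core v ∉ X ∧ ∀ s i, tri v s i ∉ X

/-- Every triangle at `v` contains at most one selected vertex and will never contain more. -/
def Capped (X : Set (V ⊕ ((V × Fin 3) ⊕ (V × Fin 3)))) (v : V) : Prop :=
  (∀ s i j, tri v s i ∈ X → tri v s j ∈ X → i = j) ∧
    (core v ∈ X ∨ ∃ s, tri v s 0 ∈ X ∧ ∃ j, tri v (!s) j ∈ X)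

/-- Exactly one vertex of the gadget at `v` has been selected, and it is in a triangle. -/
def Half (X : Set (V ⊕ ((V × Fin 3) ⊕ (V × Fin 3)))) (v : V) : Prop :=
  core v ∉ X ∧ ∃ s i, tri v s i ∈ X ∧ (∀ j, tri v s j ∈ X → j = i) ∧ ∀ j, tri v (!s) j ∉ X

/-- The invariant of Dominator's strategy: answer a move in a triangle of a fresh gadget in the
other triangle, and otherwise select the core of a fresh gadget. -/
def DomInv (b : Bool) (X : Set (V ⊕ ((V × Fin 3) ⊕ (V × Fin 3)))) : Prop :=
  (∀ v, Fresh X v ∨ Capped X v) ∨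
    b = true ∧ ∃ w, Half X w ∧ ∀ v, v ≠ w → Fresh X v ∨ Capped X v

/-- The invariant of Staller's strategy: select the core of a gadget before both of its triangles
have been visited. -/
def StallerInv (b : Bool) (X : Set (V ⊕ ((V × Fin 3) ⊕ (V × Fin 3)))) : Prop :=
  (∀ v, Fresh X v ∨ core v ∈ X) ∨
    b = false ∧ ∃ w s, (∀ j, tri w s j ∉ X) ∧ ∀ v, v ≠ w → Fresh X v ∨ core v ∈ X

lemma capped_insert (h : Capped X v) {x} (hx : IsPlayable (hatGraph G) X x) :
    Capped (insert x X) v := by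
  obtain ⟨h₁, h₂⟩ := h
  have key : ∀ s i j, tri v s j ∈ X → tri v s i ≠ x := by
    rintro s i j hj rfl
    rcases h₂ with h₂ | ⟨t, ht, -⟩
    · exact not_isPlayable_tri (t := true) hj (Or.inl h₂) i hx
    · exact not_isPlayable_tri hj (Or.inr ht) i hx
  refine ⟨fun s i j hi hj => ?_, ?_⟩
  · rcases hi with hi | hi <;> rcases hj with hj | hj
    · exact (tri_inj.1 (hi.trans hj.symm)).2.2
    · exact absurd hi (key _ _ _ hj)
    · exact absurd hj (key _ _ _ hi)
    · exact h₁ s i j hi hj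
  · simp only [Set.mem_insert_iff]
    grind

lemma capped_insert_core (h : Fresh X v) : Capped (insert (core v) X) v := by
  obtain ⟨-, h⟩ := h
  simp [Capped, h]

lemma Half.exists_capped_insert (h : Half X v) :
    ∃ s, (∀ j, tri v s j ∉ X) ∧ Capped (insert (tri v s 0) X) v := by
  obtain ⟨hv, s, i, hi, hs, hs'⟩ := h
  refine ⟨!s, hs', ?_, Or.inr ⟨!s, by simp, i, by simp [hi]⟩⟩
  intro t j k hj hk
  simp only [Set.mem_insert_iff, tri_inj] at hj hk
  rcases Bool.eq_or_eq_not t s with rfl | rfl <;> grind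

lemma Fresh.half_insert_tri (h : Fresh X v) (s : Bool) (i : Fin 3) :
    Half (insert (tri v s i) X) v := by
  obtain ⟨hv, h⟩ := h
  refine ⟨by simp [hv], s, i, by simp, ?_, ?_⟩ <;> simp [h]

lemma fresh_insert_core {w : V} (hvw : v ≠ w) (h : Fresh X v) : Fresh (insert (core w) X) v := by
  obtain ⟨hv, h⟩ := h
  simp [Fresh, hvw, hv, h]

lemma fresh_insert_tri {w : V} {s : Bool} {i : Fin 3} (hvw : v ≠ w) (h : Fresh X v) :
    Fresh (insert (tri w s i) X) v := by
  obtain ⟨hv, h⟩ := h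
  simp [Fresh, hvw, hv, h]

lemma fresh_or_capped_insert_core {w : V} (hw : IsPlayable (hatGraph G) X (core w))
    (h : Fresh X v ∨ Capped X v) :
    Fresh (insert (core w) X) v ∨ Capped (insert (core w) X) v := by
  rcases h with h | h
  · rcases eq_or_ne v w with rfl | hvw
    · exact Or.inr (capped_insert_core h)
    · exact Or.inl (fresh_insert_core hvw h)
  · exact Or.inr (capped_insert h hw)

lemma fresh_or_capped_insert_tri {w : V} {s : Bool} {i : Fin 3} (hvw : v ≠ w)
    (hw : IsPlayable (hatGraph G) X (tri w s i)) (h : Fresh X v ∨ Capped X v) :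
    Fresh (insert (tri w s i) X) v ∨ Capped (insert (tri w s i) X) v :=
  h.imp (fresh_insert_tri hvw) (capped_insert · hw)

lemma DomInv.insert_of_isPlayable {x} (h : DomInv false X) (hx : IsPlayable (hatGraph G) X x) :
    DomInv true (insert x X) := by
  have h : ∀ v, Fresh X v ∨ Capped X v := by simpa [DomInv] using h
  rcases eq_core_or_eq_tri x with ⟨w, rfl⟩ | ⟨w, s, i, rfl⟩
  · exact Or.inl fun v => fresh_or_capped_insert_core hx (h v)
  · rcases h w with hw | hw
    · exact Or.inr ⟨rfl, w, hw.half_insert_tri s i,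
        fun v hvw => fresh_or_capped_insert_tri hvw hx (h v)⟩
    · refine Or.inl fun v => ?_
      rcases eq_or_ne v w with rfl | hvw
      · exact Or.inr (capped_insert hw hx)
      · exact fresh_or_capped_insert_tri hvw hx (h v)

lemma DomInv.exists_isPlayable (h : DomInv true X) (hex : ∃ x, IsPlayable (hatGraph G) X x) :
    ∃ x, IsPlayable (hatGraph G) X x ∧ DomInv false (insert x X) := by
  rcases h with h | ⟨-, w, hw, h⟩
  · by_cases hf : ∃ w, Fresh X w
    · obtain ⟨w, hw⟩ := hf
      have hp := isPlayable_core (G := G) (hw.2 true) hw.1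
      exact ⟨_, hp, Or.inl fun v => fresh_or_capped_insert_core hp (h v)⟩
    · obtain ⟨x, hx⟩ := hex
      exact ⟨x, hx, Or.inl fun v =>
        Or.inr (capped_insert ((h v).resolve_left fun hv => hf ⟨v, hv⟩) hx)⟩
  · obtain ⟨s, hs, hc⟩ := hw.exists_capped_insert
    have hp := isPlayable_tri (G := G) hs 0
    refine ⟨_, hp, Or.inl fun v => ?_⟩
    rcases eq_or_ne v w with rfl | hvw
    · exact Or.inr hc
    · exact fresh_or_capped_insert_tri hvw hp (h v hvw)

lemma fresh_or_core_mem_insert_core {w : V} (h : v ≠ w → Fresh X v ∨ core v ∈ X) :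
    Fresh (insert (core w) X) v ∨ core v ∈ insert (core w) X := by
  rcases eq_or_ne v w with rfl | hvw
  · exact Or.inr (Set.mem_insert _ _)
  · exact (h hvw).imp (fresh_insert_core hvw) Or.inr

lemma stallerInv_insert {x} (h : StallerInv true X) : StallerInv false (insert x X) := by
  have h : ∀ v, Fresh X v ∨ core v ∈ X := by simpa [StallerInv] using h
  rcases eq_core_or_eq_tri x with ⟨w, rfl⟩ | ⟨w, s, i, rfl⟩
  · exact Or.inl fun v => fresh_or_core_mem_insert_core fun _ => h v
  · have hne : ∀ v, v ≠ w → Fresh (insert (tri w s i) X) v ∨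
        core v ∈ insert (tri w s i) X :=
      fun v hvw => (h v).imp (fresh_insert_tri hvw) Or.inr
    rcases h w with hw | hw
    · exact Or.inr ⟨rfl, w, !s, by simp [hw.2], hne⟩
    · refine Or.inl fun v => ?_
      rcases eq_or_ne v w with rfl | hvw
      · exact Or.inr (Or.inr hw)
      · exact hne v hvw

lemma StallerInv.exists_isPlayable (h : StallerInv false X)
    (hex : ∃ x, IsPlayable (hatGraph G) X x) :
    ∃ x, IsPlayable (hatGraph G) X x ∧ StallerInv true (insert x X) := by
  by_cases hall : ∀ v, core v ∈ X
  · obtain ⟨x, hx⟩ := hex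
    exact ⟨x, hx, Or.inl fun v => Or.inr (Or.inr (hall v))⟩
  · obtain ⟨w, s, hw, hs, hne⟩ : ∃ w s, core w ∉ X ∧ (∀ j, tri w s j ∉ X) ∧
        ∀ v, v ≠ w → Fresh X v ∨ core v ∈ X := by
      push Not at hall
      obtain ⟨u, hu⟩ := hall
      rcases h with h | ⟨-, w, s, hs, h⟩
      · exact ⟨u, true, hu, ((h u).resolve_right hu).2 true, fun v _ => h v⟩
      · by_cases hw : core w ∈ X
        · have huw : u ≠ w := fun e => hu (e ▸ hw)
          refine ⟨u, true, hu, ((h u huw).resolve_right hu).2 true, fun v _ => ?_⟩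
          by_cases hvw : v = w
          · exact Or.inr (hvw ▸ hw)
          · exact h v hvw
        · exact ⟨w, s, hw, hs, h⟩
    exact ⟨_, isPlayable_core hs hw, Or.inl fun v => fresh_or_core_mem_insert_core (hne v)⟩

lemma DomInv.ncard_le [Fintype V] {b : Bool} (h : DomInv b X) :
    X.ncard ≤ 3 * Fintype.card V := by
  classical
  have hv : ∀ v, Fresh X v ∨ Capped X v ∨ Half X v := by
    intro v
    rcases h with h | ⟨-, w, hw, h⟩
    · have := h v
      tauto
    · rcases eq_or_ne v w with rfl | hvw
      · exact Or.inr (Or.inr hw)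
      · have := h v hvw
        tauto
  rw [ncard_eq_sum_gadget, mul_comm, ← smul_eq_mul, ← Finset.card_univ]
  refine Finset.sum_le_card_nsmul _ _ _ fun v _ => ?_
  have hone : ∀ s i j, tri v s i ∈ X → tri v s j ∈ X → i = j := by
    rcases hv v with h | h | ⟨-, t, i, -, h, h'⟩
    · exact fun s i _ hi => absurd hi (h.2 s i)
    · exact h.1
    · intro s j k hj hk
      rcases Bool.eq_or_eq_not s t with rfl | rfl
      · rw [h j hj, h k hk]
      · exact absurd hj (h' j)
  have hsum : ∀ s, (∑ i, if tri v s i ∈ X then 1 else 0) ≤ 1 := by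
    intro s
    rw [← Finset.card_filter, Finset.card_le_one]
    simp only [Finset.mem_filter_univ]
    exact fun i hi j hj => hone s i j hi hj
  have := hsum true
  have := hsum false
  split_ifs <;> omega

lemma StallerInv.le_ncard [Fintype V] {b : Bool} (h : StallerInv b X)
    (hend : ¬ ∃ x, IsPlayable (hatGraph G) X x) : 3 * Fintype.card V ≤ X.ncard := by
  classical
  have htri : ∀ v s, ∃ i, tri v s i ∈ X := by
    intro v s
    by_contra! hs
    exact hend ⟨_, isPlayable_tri hs 0⟩
  have hcore : ∀ v, core v ∈ X := by
    intro v
    have of_or : Fresh X v ∨ core v ∈ X → core v ∈ X := by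
      rintro (hv | hv)
      · exact absurd ⟨_, isPlayable_tri (hv.2 true) 0⟩ hend
      · exact hv
    rcases h with h | ⟨-, w, s, hs, -⟩
    · exact of_or (h v)
    · exact absurd ⟨_, isPlayable_tri hs 0⟩ hend
  rw [ncard_eq_sum_gadget, mul_comm, ← smul_eq_mul, ← Finset.card_univ]
  refine Finset.card_nsmul_le_sum _ _ _ fun v _ => ?_
  have hsum : ∀ s, 1 ≤ ∑ i, if tri v s i ∈ X then 1 else 0 := by
    intro s
    rw [← Finset.card_filter, Nat.one_le_iff_ne_zero, Finset.card_ne_zero]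
    obtain ⟨i, hi⟩ := htri v s
    exact ⟨i, by simpa using hi⟩
  have := hsum true
  have := hsum false
  rw [if_pos (hcore v)]
  omega

lemma isoGameVal_hatGraph_empty [Fintype V] (G : SimpleGraph V) {k : ℕ}
    (hk : 3 * Fintype.card V ≤ k) (b : Bool) :
    isoGameVal (hatGraph G) k b ∅ = 3 * Fintype.card V := by
  have hfresh : ∀ v : V, Fresh ∅ v := fun v => by simp [Fresh]
  apply le_antisymm
  · simpa using isoGameVal_add_ncard_le (H := hatGraph G) DomInv (fun _ _ h => h.ncard_le)
      (fun _ _ h hx => h.insert_of_isPlayable hx) (fun _ h hex => h.exists_isPlayable hex)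
      k b ∅ (Or.inl fun v => Or.inl (hfresh v))
  · simpa using le_isoGameVal_add_ncard (H := hatGraph G) StallerInv
      (fun _ _ h hend => h.le_ncard hend) (fun _ _ h _ => stallerInv_insert h)
      (fun _ h hex => h.exists_isPlayable hex)
      k b ∅ (Or.inl fun v => Or.inl (hfresh v)) (by simpa using hk)

end HatGraph

/-- Proposition 5.2: for any finite graph `G` of order `m`, the graph `Ĝ` has order `7m`
and `ι_g(Ĝ) = ι_g'(Ĝ) = 3m = (3/7)·|V(Ĝ)|`. -/
theorem hatGraph_game_isolation {V : Type*} [Fintype V] (G : SimpleGraph V) :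
    Fintype.card (V ⊕ ((V × Fin 3) ⊕ (V × Fin 3))) = 7 * Fintype.card V ∧
    iotaGame (hatGraph G) = 3 * Fintype.card V ∧
    iotaGame' (hatGraph G) = 3 * Fintype.card V := by
  have hcard : Fintype.card (V ⊕ ((V × Fin 3) ⊕ (V × Fin 3))) = 7 * Fintype.card V := by
    simp only [Fintype.card_sum, Fintype.card_prod, Fintype.card_fin]
    ring
  exact ⟨hcard, isoGameVal_hatGraph_empty G (by omega) true,
    isoGameVal_hatGraph_empty G (by omega) false⟩
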